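/- arXiv:2307.10285 — 4 statements merged into one kernel-verified Lean document; each statement's English description precedes it below -/
import Mathlib

section
/- For every pair of indices a, b (each a pair of tuples in (Fin T → {0,…,n}) × (Fin T → {0,…,n})) of the Choi matrix Ω_x of the T-fold phase oracle, there exists a multivariate real polynomial in x_1,…,x_n of total degree at most 2T whose evaluation at x̂ equals the entry Ω_x[a,b], for every x ∈ {0,1}^n. -/
open Matrix Kronecker

/-- Extended input: `x̃ 0 = 0`, `x̃ i = x i` for `1 ≤ i ≤ n` (as a real 0/1 value). -/
def xt (n : ℕ) (x : Fin n → Bool) : Fin (n + 1) → ℝ :=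
  Fin.cases 0 (fun i => if x i then 1 else 0)

/-- The phase oracle `O_x`, an `(n+1) × (n+1)` diagonal complex matrix. -/
def phaseOracle (n : ℕ) (x : Fin n → Bool) : Matrix (Fin (n + 1)) (Fin (n + 1)) ℂ :=
  fun i j => if i = j then ((1 - 2 * xt n x i : ℝ) : ℂ) else 0

/-- The T-fold Kronecker power `O_x^{⊗T}`, indexed by tuples `Fin T → Fin (n+1)`. -/
def oraclePow (n T : ℕ) (x : Fin n → Bool) :
    Matrix (Fin T → Fin (n + 1)) (Fin T → Fin (n + 1)) ℂ :=
  fun i j => ∏ t, phaseOracle n x (i t) (j t)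

/-- The Choi matrix of a matrix `U` with columns indexed by `X` and rows indexed by `Y`. -/
def choiMatrix {X Y : Type*} (U : Matrix Y X ℂ) : Matrix (X × Y) (X × Y) ℂ :=
  fun p q => U p.2 p.1 * star (U q.2 q.1)

/-- `Ω_x = Choi(O_x^{⊗T})`. -/
def Omega (n T : ℕ) (x : Fin n → Bool) :
    Matrix ((Fin T → Fin (n + 1)) × (Fin T → Fin (n + 1)))
      ((Fin T → Fin (n + 1)) × (Fin T → Fin (n + 1))) ℂ :=
  choiMatrix (oraclePow n T x)

/-- The 0/1 real vector `x̂` corresponding to `x ∈ {0,1}^n`. -/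
def xhat (n : ℕ) (x : Fin n → Bool) : Fin n → ℝ := fun i => if x i then 1 else 0

/-- Every entry of the phase oracle is a real polynomial of degree at most one in the input. -/
theorem exists_phaseOracle_eq_eval (n : ℕ) (i j : Fin (n + 1)) :
    ∃ p : MvPolynomial (Fin n) ℝ, p.totalDegree ≤ 1 ∧
      ∀ x : Fin n → Bool, phaseOracle n x i j = ((MvPolynomial.eval (xhat n x) p : ℝ) : ℂ) := by
  by_cases h : i = j
  · subst h
    induction i using Fin.cases with
    | zero => exact ⟨1, by simp, fun x => by simp [phaseOracle, xt]⟩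
    | succ k =>
      refine ⟨1 - MvPolynomial.C 2 * MvPolynomial.X k, ?_, fun x => ?_⟩
      · refine (MvPolynomial.totalDegree_sub _ _).trans (max_le (by simp) ?_)
        exact (MvPolynomial.totalDegree_mul _ _).trans (by simp)
      · simp [phaseOracle, xt, xhat]
  · exact ⟨0, by simp, fun x => by simp [phaseOracle, h]⟩

/-- Every entry of the `T`-fold Kronecker power of the phase oracle is a real polynomial of
degree at most `T` in the input. -/
theorem exists_oraclePow_eq_eval (n T : ℕ) (i j : Fin T → Fin (n + 1)) :
    ∃ p : MvPolynomial (Fin n) ℝ, p.totalDegree ≤ T ∧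
      ∀ x : Fin n → Bool, oraclePow n T x i j = ((MvPolynomial.eval (xhat n x) p : ℝ) : ℂ) := by
  choose p hdeg heval using fun t => exists_phaseOracle_eq_eval n (i t) (j t)
  refine ⟨∏ t, p t, ?_, fun x => ?_⟩
  · refine (MvPolynomial.totalDegree_finsetProd _ _).trans ?_
    exact (Finset.sum_le_sum fun t _ => hdeg t).trans (by simp)
  · simp [oraclePow, heval, map_prod]

/-- Every entry of the Choi matrix `Ω_x` of the T-fold phase oracle is a
multivariate real polynomial in `x_1, …, x_n` of total degree at most `2T`. -/
theorem choi_oracle_entry_polynomial (n T : ℕ) (hn : 1 ≤ n) (hT : 1 ≤ T)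
    (a b : (Fin T → Fin (n + 1)) × (Fin T → Fin (n + 1))) :
    ∃ p : MvPolynomial (Fin n) ℝ, p.totalDegree ≤ 2 * T ∧
      ∀ x : Fin n → Bool, Omega n T x a b = ((MvPolynomial.eval (xhat n x) p : ℝ) : ℂ) := by
  obtain ⟨p, hp, hpe⟩ := exists_oraclePow_eq_eval n T a.2 a.1
  obtain ⟨q, hq, hqe⟩ := exists_oraclePow_eq_eval n T b.2 b.1
  refine ⟨p * q, (MvPolynomial.totalDegree_mul _ _).trans (by omega), fun x => ?_⟩
  simp [Omega, choiMatrix, hpe, hqe]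
end

section
/- For every complex square matrix W indexed by the index set of Ω_x (pairs of tuples in (Fin T → {0,…,n}) × (Fin T → {0,…,n})), there exists a multivariate polynomial g with complex coefficients in the n variables x_1,…,x_n, of total degree at most 2T, such that for every x ∈ {0,1}^n, g evaluated at x̂ equals Tr(Ω_x · W). -/
open Matrix Kronecker

/-- The polynomial in `x_1, …, x_n` computing the entry `(i, j)` of the phase oracle. -/
noncomputable def phaseOraclePoly (n : ℕ) (i j : Fin (n + 1)) : MvPolynomial (Fin n) ℂ :=
  if i = j then
    Fin.cases 1 (fun k => 1 - MvPolynomial.C 2 * MvPolynomial.X k) i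
  else 0

theorem totalDegree_phaseOraclePoly_le (n : ℕ) (i j : Fin (n + 1)) :
    (phaseOraclePoly n i j).totalDegree ≤ 1 := by
  unfold phaseOraclePoly
  split_ifs
  · cases i using Fin.cases with
    | zero => simp
    | succ k =>
      refine (MvPolynomial.totalDegree_sub _ _).trans (max_le (by simp) ?_)
      refine (MvPolynomial.totalDegree_mul _ _).trans ?_
      simp
  · simp

theorem eval_phaseOraclePoly (n : ℕ) (x : Fin n → Bool) (i j : Fin (n + 1)) :
    MvPolynomial.eval (fun k => ((xhat n x k : ℝ) : ℂ)) (phaseOraclePoly n i j) =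
      phaseOracle n x i j := by
  unfold phaseOraclePoly phaseOracle
  split_ifs
  · cases i using Fin.cases with
    | zero => simp [xt]
    | succ k => cases hk : x k <;> simp [xt, xhat, hk]
  · simp

theorem star_phaseOracle (n : ℕ) (x : Fin n → Bool) (i j : Fin (n + 1)) :
    star (phaseOracle n x i j) = phaseOracle n x i j := by
  unfold phaseOracle
  split_ifs
  · exact Complex.conj_ofReal _
  · exact star_zero _

/-- The polynomial in `x_1, …, x_n` computing the entry `(i, j)` of `O_x^{⊗T}`. -/
noncomputable def oraclePowPoly (n T : ℕ) (i j : Fin T → Fin (n + 1)) :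
    MvPolynomial (Fin n) ℂ :=
  ∏ t, phaseOraclePoly n (i t) (j t)

theorem totalDegree_oraclePowPoly_le (n T : ℕ) (i j : Fin T → Fin (n + 1)) :
    (oraclePowPoly n T i j).totalDegree ≤ T := by
  refine (MvPolynomial.totalDegree_finsetProd _ _).trans ?_
  refine (Finset.sum_le_sum fun t _ => totalDegree_phaseOraclePoly_le n (i t) (j t)).trans ?_
  simp

theorem eval_oraclePowPoly (n T : ℕ) (x : Fin n → Bool) (i j : Fin T → Fin (n + 1)) :
    MvPolynomial.eval (fun k => ((xhat n x k : ℝ) : ℂ)) (oraclePowPoly n T i j) =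
      oraclePow n T x i j := by
  simp only [oraclePowPoly, oraclePow, map_prod, eval_phaseOraclePoly]

theorem star_oraclePow (n T : ℕ) (x : Fin n → Bool) (i j : Fin T → Fin (n + 1)) :
    star (oraclePow n T x i j) = oraclePow n T x i j := by
  simp only [oraclePow, star_prod, star_phaseOracle]

/-- For every complex matrix `W` on the index set of `Ω_x`, the quantity
`Tr(Ω_x · W)` is a multivariate complex polynomial in `x_1, …, x_n` of total degree at
most `2T`. -/
theorem trace_choi_oracle_polynomial (n T : ℕ) (hn : 1 ≤ n) (hT : 1 ≤ T)
    (W : Matrix ((Fin T → Fin (n + 1)) × (Fin T → Fin (n + 1)))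
      ((Fin T → Fin (n + 1)) × (Fin T → Fin (n + 1))) ℂ) :
    ∃ g : MvPolynomial (Fin n) ℂ, g.totalDegree ≤ 2 * T ∧
      ∀ x : Fin n → Bool,
        MvPolynomial.eval (fun i => ((xhat n x i : ℝ) : ℂ)) g =
          Matrix.trace (Omega n T x * W) := by
  refine ⟨∑ p, ∑ q, oraclePowPoly n T p.2 p.1 * oraclePowPoly n T q.2 q.1 *
    MvPolynomial.C (W q p), ?_, fun x => ?_⟩
  · refine MvPolynomial.totalDegree_finsetSum_le fun p _ =>
      MvPolynomial.totalDegree_finsetSum_le fun q _ => ?_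
    refine (MvPolynomial.totalDegree_mul _ _).trans ?_
    have hpq := MvPolynomial.totalDegree_mul
      (oraclePowPoly n T p.2 p.1) (oraclePowPoly n T q.2 q.1)
    have hp := totalDegree_oraclePowPoly_le n T p.2 p.1
    have hq := totalDegree_oraclePowPoly_le n T q.2 q.1
    rw [MvPolynomial.totalDegree_C]
    omega
  · simp only [map_sum, map_mul, MvPolynomial.eval_C, eval_oraclePowPoly, Matrix.trace,
      Matrix.diag_apply, Matrix.mul_apply, Omega, choiMatrix, star_oraclePow]
end

section
/- (Weak SDP duality for the minimum-error query problem.) Let f : {0,1}^n → {0,1} and write F^[i] = {x ∈ {0,1}^n : f(x) = i}. Suppose: ε is a real number with ε ≥ 0; W_0 and W_1 are positive semidefinite complex square matrices indexed by (Fin T → {0,…,n}) × (Fin T → {0,…,n}); for each i ∈ {0,1} and each x ∈ F^[i], the real part of Tr(W_i · Ω_x) is at least 1 − ε; λ : {0,1}^n → ℝ satisfies λ_x ≥ 0 for all x and ∑_x λ_x ≤ 1; and S is a Hermitian matrix of the same size such that for each i ∈ {0,1} the matrix S − ∑_{x ∈ F^[i]} λ_x · Ω_x is positive semidefinite. Then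 ∑_{x ∈ {0,1}^n} λ_x − Re Tr(S·(W_0 + W_1)) ≤ ε. -/
open Matrix Kronecker

open scoped ComplexOrder

namespace Matrix

/-- The trace of a product of two positive semidefinite matrices is nonnegative. -/
theorem PosSemidef.trace_mul_nonneg {ι : Type*} [Fintype ι] {A B : Matrix ι ι ℂ}
    (hA : A.PosSemidef) (hB : B.PosSemidef) : 0 ≤ (A * B).trace := by
  obtain ⟨m, v, rfl⟩ := posSemidef_iff_eq_sum_vecMulVec.mp hB
  rw [Matrix.mul_sum, trace_sum]
  refine Finset.sum_nonneg fun i _ => ?_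
  rw [mul_vecMulVec, trace_vecMulVec, dotProduct_comm]
  exact hA.dotProduct_mulVec_nonneg (v i)

/-- If `S` dominates `∑ x ∈ s, c x • M x` in the Loewner order, and `W` is positive semidefinite
with `a ≤ Re Tr(W * M x)` for all `x ∈ s`, then `(∑ x ∈ s, c x) * a ≤ Re Tr(S * W)`. -/
theorem sum_mul_le_re_trace_mul {ι κ : Type*} [Fintype ι] {s : Finset κ} {c : κ → ℝ} {a : ℝ}
    {M : κ → Matrix ι ι ℂ} {S W : Matrix ι ι ℂ} (hc : ∀ x ∈ s, 0 ≤ c x)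
    (hW : W.PosSemidef) (hS : (S - ∑ x ∈ s, (c x : ℂ) • M x).PosSemidef)
    (ha : ∀ x ∈ s, a ≤ (W * M x).trace.re) :
    (∑ x ∈ s, c x) * a ≤ (S * W).trace.re := by
  have h := (Complex.le_def.mp (hS.trace_mul_nonneg hW)).1
  have hsum : ((∑ x ∈ s, (c x : ℂ) • M x) * W).trace.re = ∑ x ∈ s, c x * (W * M x).trace.re := by
    rw [Finset.sum_mul, trace_sum, Complex.re_sum]
    refine Finset.sum_congr rfl fun x _ => ?_
    rw [Matrix.smul_mul, trace_smul, smul_eq_mul, Complex.re_ofReal_mul, trace_mul_comm]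
  rw [Matrix.sub_mul, trace_sub, Complex.sub_re, hsum, Complex.zero_re] at h
  calc (∑ x ∈ s, c x) * a ≤ ∑ x ∈ s, c x * (W * M x).trace.re := by
        rw [Finset.sum_mul]
        exact Finset.sum_le_sum fun x hx => mul_le_mul_of_nonneg_left (ha x hx) (hc x hx)
    _ ≤ (S * W).trace.re := sub_nonneg.mp h

end Matrix

/-- **weak SDP duality for the minimum-error query problem.** Any feasible
dual solution `(λ, S)` lower-bounds the error `ε` of any feasible primal superinstrument
`(W_0, W_1)` computing `f` with `T` queries. -/
theorem weak_duality_min_error (n T : ℕ) (hn : 1 ≤ n) (hT : 1 ≤ T)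
    (f : (Fin n → Bool) → Fin 2)
    (ε : ℝ) (hε : 0 ≤ ε)
    (W0 W1 : Matrix ((Fin T → Fin (n + 1)) × (Fin T → Fin (n + 1)))
      ((Fin T → Fin (n + 1)) × (Fin T → Fin (n + 1))) ℂ)
    (hW0 : W0.PosSemidef) (hW1 : W1.PosSemidef)
    (hfeas : ∀ x : Fin n → Bool,
      1 - ε ≤ (Matrix.trace ((if f x = 0 then W0 else W1) * Omega n T x)).re)
    (lam : (Fin n → Bool) → ℝ)
    (hlam : ∀ x, 0 ≤ lam x)
    (hlamsum : ∑ x : Fin n → Bool, lam x ≤ 1)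
    (S : Matrix ((Fin T → Fin (n + 1)) × (Fin T → Fin (n + 1)))
      ((Fin T → Fin (n + 1)) × (Fin T → Fin (n + 1))) ℂ)
    (hS : S.IsHermitian)
    (hSpos : ∀ i : Fin 2,
      (S - ∑ x ∈ Finset.univ.filter (fun x : Fin n → Bool => f x = i),
        ((lam x : ℝ) : ℂ) • Omega n T x).PosSemidef) :
    (∑ x : Fin n → Bool, lam x) - (Matrix.trace (S * (W0 + W1))).re ≤ ε := by
  have h0 := sum_mul_le_re_trace_mul (fun x _ => hlam x) hW0 (hSpos 0) (a := 1 - ε)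
    fun x hx => by simpa [(Finset.mem_filter.mp hx).2] using hfeas x
  have h1 := sum_mul_le_re_trace_mul (fun x _ => hlam x) hW1 (hSpos 1) (a := 1 - ε)
    fun x hx => by simpa [(Finset.mem_filter.mp hx).2] using hfeas x
  have hsplit := Finset.sum_fiberwise Finset.univ f lam
  rw [Fin.sum_univ_two] at hsplit
  rw [Matrix.mul_add, trace_add, Complex.add_re]
  have hε' := mul_le_mul_of_nonneg_left hlamsum hε
  rw [← hsplit] at hε' ⊢
  linarith
end

section
/- The link product is associative: for finite types X, Y, Z, V and complex square matrices M indexed by X×Y, N indexed by Y×Z, and P indexed by Z×V (so that each Hilbert space factor appears in at most two of the matrices), one has (M * N) * P = M * (N * P) as matrices indexed by X×V. -/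
open Matrix

/-- The link product of Choi matrices: for `M` indexed by `X × Y` and `N` indexed by
`Y × Z`, `(M * N)_{(x,z),(x',z')} = ∑_{u,v} M_{(x,u),(x',v)} · N_{(u,z),(v,z')}`. -/
noncomputable def linkProd {X Y Z : Type*} [Fintype Y]
    (M : Matrix (X × Y) (X × Y) ℂ) (N : Matrix (Y × Z) (Y × Z) ℂ) :
    Matrix (X × Z) (X × Z) ℂ :=
  fun p q => ∑ u : Y, ∑ v : Y, M (p.1, u) (q.1, v) * N (u, p.2) (v, q.2)

/-- The link product is associative. -/
theorem linkProd_assoc {X Y Z V : Type*} [Fintype X] [Fintype Y] [Fintype Z] [Fintype V]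
    (M : Matrix (X × Y) (X × Y) ℂ) (N : Matrix (Y × Z) (Y × Z) ℂ)
    (P : Matrix (Z × V) (Z × V) ℂ) :
    linkProd (linkProd M N) P = linkProd M (linkProd N P) := by
  ext p q
  simp only [linkProd, Finset.sum_mul, Finset.mul_sum, ← Fintype.sum_prod_type']
  let e : Z × Z × Y × Y ≃ Y × Y × Z × Z :=
    (Equiv.prodAssoc Z Z (Y × Y)).symm.trans
      ((Equiv.prodComm (Z × Z) (Y × Y)).trans (Equiv.prodAssoc Y Y (Z × Z)))
  exact Fintype.sum_equiv e _ _ fun _ => mul_assoc _ _ _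
end
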